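/- arXiv:2201.08000 — 2 statements merged into one kernel-verified Lean document; each statement's English description precedes it below -/
import Mathlib

section
/- Let 𝒜 be an abelian category with enough projective objects. Suppose given Gorenstein projective objects X, Y, Z, X', Y', Z', monomorphisms f : X → Y and f' : X' → Y' whose cokernels are Gorenstein projective, morphisms g : X → Z and g' : X' → Z', and morphisms α : X → X', β : Y → Y', γ : Z → Z' that are stable isomorphisms and satisfy β∘f = f'∘α and γ∘g = g'∘α. Then the induced morphism Y ⊔_X Z → Y' ⊔_{X'} Z' between the pushouts (computed in 𝒜) is a stable isomorphism. -/
open CategoryTheory CategoryTheory.Limits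

section GorensteinPrelude

variable {C : Type*} [Category C] [Abelian C]

/-- A totally acyclic complex of projective objects, encoded by its objects `P n` and
differentials `d n : P n ⟶ P (n + 1)`: each `P n` is projective, consecutive differentials
compose to zero, the complex is acyclic (exact at each spot), and it stays exact after
applying `Hom(-, Q)` for every projective object `Q`. -/
structure IsTotallyAcyclic (P : ℤ → C) (d : ∀ n : ℤ, P n ⟶ P (n + 1)) : Prop where
  projective : ∀ n, Projective (P n)
  comp_eq_zero : ∀ n, d n ≫ d (n + 1) = 0
  exact : ∀ n, (ShortComplex.mk (d n) (d (n + 1)) (comp_eq_zero n)).Exact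
  hom_exact : ∀ (Q : C), Projective Q → ∀ n,
    Function.Exact (fun g : P (n + 1 + 1) ⟶ Q => d (n + 1) ≫ g)
      (fun g : P (n + 1) ⟶ Q => d n ≫ g)

/-- An object is Gorenstein projective if it is isomorphic to a cycle object of some
totally acyclic complex of projective objects. -/
def IsGorensteinProjective (M : C) : Prop :=
  ∃ (P : ℤ → C) (d : ∀ n : ℤ, P n ⟶ P (n + 1)) (_ : IsTotallyAcyclic P d) (n : ℤ),
    Nonempty (M ≅ kernel (d n))

/-- `pdLE n X` : `X` admits a projective resolution of length at most `n`,
i.e. an exact sequence `0 → P_n → ⋯ → P_0 → X → 0` with every `P_i` projective. -/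
def pdLE : ℕ → C → Prop
  | 0, X => Projective X
  | (n + 1), X => ∃ (K P : C) (i : K ⟶ P) (p : P ⟶ X) (w : i ≫ p = 0),
      Projective P ∧ (ShortComplex.mk i p w).ShortExact ∧ pdLE n K

/-- `X` has finite projective dimension. -/
def HasFinitePd (X : C) : Prop := ∃ n, pdLE n X

/-- `gpdLE n X` : `X` admits a Gorenstein projective resolution of length at most `n`,
i.e. an exact sequence `0 → G_n → ⋯ → G_0 → X → 0` with every `G_i` Gorenstein projective. -/
def gpdLE : ℕ → C → Prop
  | 0, X => IsGorensteinProjective X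
  | (n + 1), X => ∃ (K G : C) (i : K ⟶ G) (p : G ⟶ X) (w : i ≫ p = 0),
      IsGorensteinProjective G ∧ (ShortComplex.mk i p w).ShortExact ∧ gpdLE n K

/-- `X` has finite Gorenstein projective dimension. -/
def HasFiniteGpd (X : C) : Prop := ∃ n, gpdLE n X

/-- A morphism factors through a projective object. -/
def FactorsThroughProjective {X Y : C} (f : X ⟶ Y) : Prop :=
  ∃ (P : C) (_ : Projective P) (a : X ⟶ P) (b : P ⟶ Y), f = a ≫ b

/-- Two parallel morphisms become equal in the stable category, i.e. their difference
factors through a projective object. -/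
def StablyEqual {X Y : C} (f g : X ⟶ Y) : Prop := FactorsThroughProjective (f - g)

/-- A morphism is a stable isomorphism if it becomes invertible in the stable category
(morphisms modulo those factoring through a projective object). -/
def IsStableIso {X Y : C} (f : X ⟶ Y) : Prop :=
  ∃ g : Y ⟶ X, StablyEqual (f ≫ g) (𝟙 X) ∧ StablyEqual (g ≫ f) (𝟙 Y)

end GorensteinPrelude

section StableCategory

variable {C : Type*} [Category C]

namespace FactorsThroughProjective

lemma comp_left {X Y Z : C} {f : Y ⟶ Z} (hf : FactorsThroughProjective f) (g : X ⟶ Y) :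
    FactorsThroughProjective (g ≫ f) := by
  obtain ⟨P, hP, a, b, rfl⟩ := hf
  exact ⟨P, hP, g ≫ a, b, by simp⟩

lemma comp_right {X Y Z : C} {f : X ⟶ Y} (hf : FactorsThroughProjective f) (g : Y ⟶ Z) :
    FactorsThroughProjective (f ≫ g) := by
  obtain ⟨P, hP, a, b, rfl⟩ := hf
  exact ⟨P, hP, a, b ≫ g, by simp⟩

variable [Abelian C]

lemma neg {X Y : C} {f : X ⟶ Y} (hf : FactorsThroughProjective f) :
    FactorsThroughProjective (-f) := by
  obtain ⟨P, hP, a, b, rfl⟩ := hf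
  exact ⟨P, hP, -a, b, by simp⟩

lemma add {X Y : C} {f g : X ⟶ Y} (hf : FactorsThroughProjective f)
    (hg : FactorsThroughProjective g) : FactorsThroughProjective (f + g) := by
  obtain ⟨P, hP, a, b, rfl⟩ := hf
  obtain ⟨Q, hQ, c, d, rfl⟩ := hg
  exact ⟨P ⊞ Q, inferInstance, biprod.lift a c, biprod.desc b d, by simp⟩

lemma sub {X Y : C} {f g : X ⟶ Y} (hf : FactorsThroughProjective f)
    (hg : FactorsThroughProjective g) : FactorsThroughProjective (f - g) := by
  rw [sub_eq_add_neg]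
  exact hf.add hg.neg

end FactorsThroughProjective

variable [Abelian C]

open ZeroObject in
lemma factorsThroughProjective_zero (X Y : C) :
    FactorsThroughProjective (0 : X ⟶ Y) :=
  ⟨0, inferInstance, 0, 0, by simp⟩

namespace IsStableIso

lemma comp {X Y Z : C} {f : X ⟶ Y} {g : Y ⟶ Z} (hf : IsStableIso f) (hg : IsStableIso g) :
    IsStableIso (f ≫ g) := by
  obtain ⟨f', hf₁, hf₂⟩ := hf
  obtain ⟨g', hg₁, hg₂⟩ := hg
  refine ⟨g' ≫ f', ?_, ?_⟩
  · have := ((hg₁.comp_left f).comp_right f').add hf₁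
    simpa [StablyEqual] using this
  · have := ((hf₂.comp_left g').comp_right g).add hg₂
    simpa [StablyEqual] using this

/-- A section of a stable isomorphism is a stable isomorphism. -/
lemma of_section {X Y : C} {i : X ⟶ Y} {p : Y ⟶ X} (hp : IsStableIso p) (h : i ≫ p = 𝟙 X) :
    IsStableIso i := by
  obtain ⟨q, hq, -⟩ := hp
  refine ⟨p, by simpa [StablyEqual, h] using factorsThroughProjective_zero X X, ?_⟩
  have := FactorsThroughProjective.comp_left hq (p ≫ i)
  have e : (p ≫ q - 𝟙 Y) - (p ≫ i) ≫ (p ≫ q - 𝟙 Y) = p ≫ i - 𝟙 Y := by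
    simp [reassoc_of% h]
  rw [StablyEqual, ← e]
  exact FactorsThroughProjective.sub hq this

lemma biprod_inl (X Q : C) [Projective Q] : IsStableIso (biprod.inl : X ⟶ X ⊞ Q) := by
  refine ⟨biprod.fst, by simpa [StablyEqual] using factorsThroughProjective_zero X X,
    Q, inferInstance, -biprod.snd, biprod.inr, ?_⟩
  ext <;> simp

lemma biprod_fst (X Q : C) [Projective Q] : IsStableIso (biprod.fst : X ⊞ Q ⟶ X) := by
  refine ⟨biprod.inl, ⟨Q, inferInstance, -biprod.snd, biprod.inr, ?_⟩,
    by simpa [StablyEqual] using factorsThroughProjective_zero X X⟩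
  ext <;> simp

/-- Stable isomorphisms are invariant under stable equality. -/
lemma of_stablyEqual {X Y : C} {f g : X ⟶ Y} (hf : IsStableIso f) (h : StablyEqual g f) :
    IsStableIso g := by
  obtain ⟨k, h₁, h₂⟩ := hf
  refine ⟨k, ?_, ?_⟩
  · have := (h.comp_right k).add h₁
    simpa [StablyEqual] using this
  · have := (h.comp_left k).add h₂
    simpa [StablyEqual] using this

lemma biprod_desc {X Y Q : C} [Projective Q] {f : X ⟶ Y} (hf : IsStableIso f) (h : Q ⟶ Y) :
    IsStableIso (biprod.desc f h) := by
  refine ((biprod_fst X Q).comp hf).of_stablyEqual ⟨Q, inferInstance, biprod.snd, h, ?_⟩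
  ext <;> simp

/-- An epimorphism which is a stable isomorphism splits and its kernel is projective. -/
lemma exists_section {X Y : C} {p : X ⟶ Y} [Epi p] (hp : IsStableIso p) :
    ∃ s : Y ⟶ X, s ≫ p = 𝟙 Y ∧ Projective (kernel p) := by
  obtain ⟨q, h₁, P, hP, c, d, hcd⟩ := hp
  obtain ⟨s, hs, hps⟩ : ∃ s : Y ⟶ X, s ≫ p = 𝟙 Y ∧ StablyEqual (p ≫ s) (𝟙 X) := by
    refine ⟨q - c ≫ Projective.factorThru d p, ?_, ?_⟩
    · simp [← hcd]
    · have : FactorsThroughProjective (p ≫ c ≫ Projective.factorThru d p) :=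
        ⟨P, hP, p ≫ c, Projective.factorThru d p, by simp⟩
      have := FactorsThroughProjective.sub h₁ this
      have e : p ≫ (q - c ≫ Projective.factorThru d p) - 𝟙 X =
        p ≫ q - 𝟙 X - p ≫ c ≫ Projective.factorThru d p := by simp; abel
      rwa [StablyEqual, e]
  refine ⟨s, hs, ?_⟩
  obtain ⟨Q, hQ, a, b, hab⟩ := hps
  have w : (𝟙 X - p ≫ s) ≫ p = 0 := by simp [hs]
  refine (Retract.mk (kernel.ι p ≫ a) (-b ≫ kernel.lift p (𝟙 X - p ≫ s) w) ?_).projective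
  rw [← cancel_mono (kernel.ι p)]
  simp [← reassoc_of% hab]

end IsStableIso

/-- Every morphism from the source of `f` to a projective object extends along `f`. -/
def ExtendsToProjectives {X Y : C} (f : X ⟶ Y) : Prop :=
  ∀ ⦃Q : C⦄, Projective Q → ∀ a : X ⟶ Q, ∃ b : Y ⟶ Q, f ≫ b = a

lemma comp_biprod_desc {W X Y Z : C} (k : W ⟶ X ⊞ Y) (a : X ⟶ Z) (b : Y ⟶ Z) :
    k ≫ biprod.desc a b = (k ≫ biprod.fst) ≫ a + (k ≫ biprod.snd) ≫ b := by
  simp [biprod.desc_eq]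

/-- Monomorphisms with Gorenstein projective cokernel extend maps to projective objects. -/
lemma IsGorensteinProjective.extendsToProjectives {X Y : C} (f : X ⟶ Y) [Mono f]
    (hf : IsGorensteinProjective (cokernel f)) : ExtendsToProjectives f := by
  intro Q hQ a
  obtain ⟨P, d, hd, n, ⟨e⟩⟩ := hf
  obtain ⟨m, rfl⟩ : ∃ m, n = m + 1 + 1 + 1 := ⟨n - 3, by ring⟩
  have := hd.projective (m + 1 + 1)
  let c : P (m + 1 + 1) ⟶ cokernel f :=
    kernel.lift _ (d (m + 1 + 1)) (hd.comp_eq_zero _) ≫ e.inv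
  have : Epi (kernel.lift _ (d (m + 1 + 1)) (hd.comp_eq_zero _)) :=
    (hd.exact (m + 1 + 1)).epi_kernelLift
  have hc : c ≫ e.hom ≫ kernel.ι _ = d (m + 1 + 1) := by simp [c]
  have : Epi c := epi_comp _ _
  let t : P (m + 1 + 1) ⟶ Y := Projective.factorThru c (cokernel.π f)
  have ht : t ≫ cokernel.π f = c := Projective.factorThru_comp _ _
  have hdc : d (m + 1) ≫ c = 0 := by
    rw [← cancel_mono e.hom, ← cancel_mono (kernel.ι _)]
    simp only [Category.assoc, hc, zero_comp]
    exact hd.comp_eq_zero _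
  let k : P (m + 1) ⟶ X :=
    Abelian.monoLift f (d (m + 1) ≫ t) (by rw [Category.assoc, ht, hdc])
  have hk : k ≫ f = d (m + 1) ≫ t := Abelian.monoLift_comp _ _ _
  have hdk : d m ≫ k = 0 := by
    rw [← cancel_mono f, Category.assoc, hk, ← Category.assoc, hd.comp_eq_zero]
    simp
  obtain ⟨h, hh⟩ := (hd.hom_exact Q hQ m (k ≫ a)).1 (by simp [reassoc_of% hdk])
  have hh' : d (m + 1) ≫ h = k ≫ a := hh
  have hepi : Epi (biprod.desc f t) := by
    refine Preadditive.epi_of_cancel_zero _ fun z hz ↦ ?_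
    have h₁ : f ≫ z = 0 := by simpa using biprod.inl ≫= hz
    have h₂ : t ≫ z = 0 := by simpa using biprod.inr ≫= hz
    rw [← cokernel.π_desc f z h₁] at h₂ ⊢
    rw [reassoc_of% ht] at h₂
    rw [zero_of_epi_comp c h₂]
    simp
  have hker : kernel.ι (biprod.desc f t) ≫ biprod.desc a h = 0 := by
    have hw : (kernel.ι (biprod.desc f t) ≫ biprod.fst) ≫ f +
        (kernel.ι (biprod.desc f t) ≫ biprod.snd) ≫ t = 0 := by
      rw [← comp_biprod_desc, kernel.condition]
    have hx : (kernel.ι (biprod.desc f t) ≫ biprod.snd) ≫ d (m + 1 + 1) = 0 := by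
      have := hw =≫ cokernel.π f
      simp only [Preadditive.add_comp, Category.assoc, cokernel.condition, comp_zero, zero_add,
        ht, zero_comp] at this
      rw [← hc, Category.assoc, reassoc_of% this, zero_comp]
    obtain ⟨A, π, hπ, x, hx⟩ := (hd.exact (m + 1)).exact_up_to_refinements _ hx
    dsimp at hx
    have hy : π ≫ kernel.ι (biprod.desc f t) ≫ biprod.fst = -(x ≫ k) := by
      rw [← cancel_mono f]
      have := π ≫= hw
      simp only [Preadditive.comp_add, Category.assoc, reassoc_of% hx, ← hk, comp_zero] at this
      simpa using eq_neg_of_add_eq_zero_left this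
    rw [← cancel_epi π, comp_biprod_desc]
    simp [reassoc_of% hy, reassoc_of% hx, hh']
  refine ⟨Abelian.epiDesc (biprod.desc f t) (biprod.desc a h) hker, ?_⟩
  have := biprod.inl ≫= Abelian.comp_epiDesc (biprod.desc f t) (biprod.desc a h) hker
  rwa [← Category.assoc, biprod.inl_desc, biprod.inl_desc] at this

/-- The gluing lemma for epimorphic stable isomorphisms. -/
lemma IsStableIso.pushout_map_of_epi {X Y Z X' Y' Z' : C} {f : X ⟶ Y} {f' : X' ⟶ Y'}
    (hf : ExtendsToProjectives f) (hf' : ExtendsToProjectives f')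
    (g : X ⟶ Z) (g' : X' ⟶ Z') {α : X ⟶ X'} {β : Y ⟶ Y'} {γ : Z ⟶ Z'} [Epi α] [Epi β] [Epi γ]
    (hα : IsStableIso α) (hβ : IsStableIso β) (hγ : IsStableIso γ)
    (w₁ : f ≫ β = α ≫ f') (w₂ : g ≫ γ = α ≫ g') :
    IsStableIso (pushout.map f g f' g' β γ α w₁ w₂) := by
  obtain ⟨s, hs, hKX⟩ := hα.exists_section
  obtain ⟨t₀, ht₀, hKY⟩ := hβ.exists_section
  obtain ⟨r, hr, hKZ⟩ := hγ.exists_section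
  obtain ⟨t, ht, hst⟩ : ∃ t : Y' ⟶ Y, t ≫ β = 𝟙 Y' ∧ f' ≫ t = s ≫ f := by
    obtain ⟨b, hb⟩ := hf' hKY (kernel.lift β (s ≫ f - f' ≫ t₀)
      (by simp [w₁, ht₀, reassoc_of% hs]))
    refine ⟨t₀ + b ≫ kernel.ι β, by simp [ht₀], ?_⟩
    simp [reassoc_of% hb]
  obtain ⟨u, hu⟩ := hf' hKZ (kernel.lift γ (s ≫ g - g' ≫ r) (by simp [w₂, hr, reassoc_of% hs]))
  have hu' : f' ≫ u ≫ kernel.ι γ = s ≫ g - g' ≫ r := by simp [reassoc_of% hu]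
  let pX : X ⟶ kernel α := kernel.lift α (𝟙 X - α ≫ s) (by simp [hs])
  let pY : Y ⟶ kernel β := kernel.lift β (𝟙 Y - β ≫ t) (by simp [ht])
  let pZ : Z ⟶ kernel γ := kernel.lift γ (𝟙 Z - γ ≫ r) (by simp [hr])
  have hpX : pX ≫ kernel.ι α = 𝟙 X - α ≫ s := kernel.lift_ι _ _ _
  have hpY : pY ≫ kernel.ι β = 𝟙 Y - β ≫ t := kernel.lift_ι _ _ _
  have hpZ : pZ ≫ kernel.ι γ = 𝟙 Z - γ ≫ r := kernel.lift_ι _ _ _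
  obtain ⟨v, hv⟩ := hf hKX pX
  let k : kernel α ⟶ kernel β := kernel.map α β f f' w₁.symm
  let l : kernel α ⟶ kernel γ := kernel.map α γ g g' w₂.symm
  have hk : k ≫ kernel.ι β = kernel.ι α ≫ f := kernel.lift_ι _ _ _
  have hl : l ≫ kernel.ι γ = kernel.ι α ≫ g := kernel.lift_ι _ _ _
  have hfY : f ≫ pY = pX ≫ k := by
    rw [← cancel_mono (kernel.ι β)]
    simp [hpY, hk, reassoc_of% hpX, reassoc_of% w₁, hst]
  have hgZ : g ≫ pZ = α ≫ f' ≫ u + pX ≫ l := by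
    rw [← cancel_mono (kernel.ι γ)]
    simp [hpZ, hl, reassoc_of% hpX, reassoc_of% w₂, hu']
  let σ : pushout f' g' ⟶ pushout f g :=
    pushout.desc (t ≫ pushout.inl f g - u ≫ kernel.ι γ ≫ pushout.inr f g)
      (r ≫ pushout.inr f g) (by
        simp [reassoc_of% hst, reassoc_of% hu', pushout.condition])
  refine ⟨σ, ?_, ?_⟩
  · let ρ : pushout f g ⟶ kernel β ⊞ kernel γ :=
      pushout.desc (biprod.lift (pY - v ≫ k) (β ≫ u + v ≫ l)) (biprod.lift 0 pZ) (by
        ext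
        · simp [hfY, reassoc_of% hv]
        · simp [hgZ, reassoc_of% hv, reassoc_of% w₁])
    refine ⟨kernel β ⊞ kernel γ, inferInstance, -ρ,
      biprod.desc (kernel.ι β ≫ pushout.inl f g) (kernel.ι γ ≫ pushout.inr f g), ?_⟩
    ext
    · simp [σ, ρ, reassoc_of% hpY, reassoc_of% hk, reassoc_of% hl, pushout.condition,
        pushout.inl_desc, pushout.inl_desc_assoc]
      abel
    · simp [σ, ρ, reassoc_of% hpZ, pushout.inr_desc, pushout.inr_desc_assoc]
  · have : σ ≫ pushout.map f g f' g' β γ α w₁ w₂ = 𝟙 _ := by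
      ext
      · simp [σ, reassoc_of% ht, pushout.inl_desc, pushout.inl_desc_assoc,
          pushout.inr_desc]
      · simp [σ, reassoc_of% hr, pushout.inr_desc, pushout.inr_desc_assoc]
    simpa [StablyEqual, this] using factorsThroughProjective_zero _ _

lemma ExtendsToProjectives.biprod_map {X Y P Q : C} {f : X ⟶ Y} {i : P ⟶ Q}
    (hf : ExtendsToProjectives f) (hi : ExtendsToProjectives i) :
    ExtendsToProjectives (biprod.map f i) := by
  intro R hR a
  obtain ⟨b, hb⟩ := hf hR (biprod.inl ≫ a)
  obtain ⟨c, hc⟩ := hi hR (biprod.inr ≫ a)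
  exact ⟨biprod.desc b c, by ext <;> simp [hb, hc]⟩

lemma extendsToProjectives_biprod_inl (P Q : C) :
    ExtendsToProjectives (biprod.inl : P ⟶ P ⊞ Q) :=
  fun _ _ a ↦ ⟨biprod.desc a 0, by simp⟩

/-- The gluing lemma for stable isomorphisms along morphisms which extend maps to projective
objects. -/
lemma IsStableIso.pushout_map [EnoughProjectives C] {X Y Z X' Y' Z' : C}
    {f : X ⟶ Y} {f' : X' ⟶ Y'}
    (hf : ExtendsToProjectives f) (hf' : ExtendsToProjectives f')
    (g : X ⟶ Z) (g' : X' ⟶ Z') {α : X ⟶ X'} {β : Y ⟶ Y'} {γ : Z ⟶ Z'}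
    (hα : IsStableIso α) (hβ : IsStableIso β) (hγ : IsStableIso γ)
    (w₁ : f ≫ β = α ≫ f') (w₂ : g ≫ γ = α ≫ g') :
    IsStableIso (pushout.map f g f' g' β γ α w₁ w₂) := by
  let P := Projective.over X'
  let Q := Projective.over Y'
  let R := Projective.over Z'
  let F : X ⊞ P ⟶ Y ⊞ (P ⊞ Q) := biprod.map f biprod.inl
  let G : X ⊞ P ⟶ Z ⊞ (P ⊞ R) := biprod.map g biprod.inl
  have hF : ExtendsToProjectives F := hf.biprod_map (extendsToProjectives_biprod_inl P Q)
  let a : X ⊞ P ⟶ X' := biprod.desc α (Projective.π X')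
  let b : Y ⊞ (P ⊞ Q) ⟶ Y' :=
    biprod.desc β (biprod.desc (Projective.π X' ≫ f') (Projective.π Y'))
  let c : Z ⊞ (P ⊞ R) ⟶ Z' :=
    biprod.desc γ (biprod.desc (Projective.π X' ≫ g') (Projective.π Z'))
  have : Epi a := epi_of_epi_fac (biprod.inr_desc _ _)
  have : Epi b := epi_of_epi_fac (f := biprod.inr ≫ biprod.inr) (h := Projective.π Y')
    (by simp [b])
  have : Epi c := epi_of_epi_fac (f := biprod.inr ≫ biprod.inr) (h := Projective.π Z')
    (by simp [c])
  have w₃ : F ≫ b = a ≫ f' := by ext <;> simp [F, a, b, w₁]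
  have w₄ : G ≫ c = a ≫ g' := by ext <;> simp [G, a, c, w₂]
  have h₁ : IsStableIso (pushout.map F G f' g' b c a w₃ w₄) :=
    pushout_map_of_epi hF hf' G g' (hα.biprod_desc _) (hβ.biprod_desc _) (hγ.biprod_desc _) w₃ w₄
  have h₂ : IsStableIso (pushout.map F G f g biprod.fst biprod.fst biprod.fst
      (by simp [F]) (by simp [G])) :=
    pushout_map_of_epi hF hf G g (biprod_fst _ _) (biprod_fst _ _) (biprod_fst _ _) _ _
  have h₃ : IsStableIso (pushout.map f g F G biprod.inl biprod.inl biprod.inl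
      (by simp [F]) (by simp [G])) :=
    h₂.of_section (by
      ext <;> simp [pushout.inl_desc, pushout.inr_desc, pushout.inl_desc_assoc,
        pushout.inr_desc_assoc])
  convert h₃.comp h₁ using 1
  ext <;> simp [b, c, pushout.inl_desc, pushout.inr_desc, pushout.inl_desc_assoc,
    pushout.inr_desc_assoc]

end StableCategory

/-- the gluing axiom, part of Lemma 4.2 of the paper. Given a commutative
diagram of Gorenstein projective objects in which `f`, `f'` are monomorphisms with
Gorenstein projective cokernels and the vertical maps `α`, `β`, `γ` are stable isomorphisms,
the induced morphism between the pushouts is a stable isomorphism. -/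
theorem pushout_map_stable_iso
    {C : Type*} [Category C] [Abelian C] [EnoughProjectives C]
    (X Y Z X' Y' Z' : C)
    (hX : IsGorensteinProjective X) (hY : IsGorensteinProjective Y)
    (hZ : IsGorensteinProjective Z) (hX' : IsGorensteinProjective X')
    (hY' : IsGorensteinProjective Y') (hZ' : IsGorensteinProjective Z')
    (f : X ⟶ Y) (f' : X' ⟶ Y') [Mono f] [Mono f']
    (hcf : IsGorensteinProjective (cokernel f)) (hcf' : IsGorensteinProjective (cokernel f'))
    (g : X ⟶ Z) (g' : X' ⟶ Z')
    (α : X ⟶ X') (β : Y ⟶ Y') (γ : Z ⟶ Z')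
    (hα : IsStableIso α) (hβ : IsStableIso β) (hγ : IsStableIso γ)
    (w₁ : f ≫ β = α ≫ f') (w₂ : g ≫ γ = α ≫ g') :
    IsStableIso (pushout.map f g f' g' β γ α w₁ w₂) := by
  exact hα.pushout_map hcf.extendsToProjectives hcf'.extendsToProjectives g g' hβ hγ w₁ w₂
end

section
/- Suppose bimodules _B M _A and _A N _B define a stable equivalence of Morita type of adjoint type between finite dimensional k-algebras A and B. Then A is CM-finite if and only if B is CM-finite. -/
open CategoryTheory CategoryTheory.Limits

universe v u₁ u₂

section FGGorensteinPrelude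

variable {A : Type u₁} [Ring A]

/-- A totally acyclic complex of finitely generated projective modules: each term is a
finitely generated projective module, consecutive differentials compose to zero, the
complex is acyclic, and it stays acyclic after applying `Hom(-, Q)` for every finitely
generated projective module `Q`. -/
structure IsFGTotallyAcyclic (P : ℤ → ModuleCat.{v} A)
    (d : ∀ n : ℤ, P n ⟶ P (n + 1)) : Prop where
  finite : ∀ n, Module.Finite A (P n)
  projective : ∀ n, Projective (P n)
  comp_eq_zero : ∀ n, d n ≫ d (n + 1) = 0
  exact : ∀ n, (ShortComplex.mk (d n) (d (n + 1)) (comp_eq_zero n)).Exact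
  hom_exact : ∀ (Q : ModuleCat.{v} A), Module.Finite A Q → Projective Q → ∀ n,
    Function.Exact (fun g : P (n + 1 + 1) ⟶ Q => d (n + 1) ≫ g)
      (fun g : P (n + 1) ⟶ Q => d n ≫ g)

/-- A finitely generated module is Gorenstein projective if it is isomorphic to a cycle
of a totally acyclic complex of finitely generated projective modules. -/
def IsFGGorensteinProjective (M : ModuleCat.{v} A) : Prop :=
  Module.Finite A M ∧
    ∃ (P : ℤ → ModuleCat.{v} A) (d : ∀ n : ℤ, P n ⟶ P (n + 1))
      (_ : IsFGTotallyAcyclic P d) (n : ℤ), Nonempty (M ≅ kernel (d n))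

/-- `fgPdLE n X` : `X` admits a resolution `0 → P_n → ⋯ → P_0 → X → 0` by finitely
generated projective modules. -/
def fgPdLE : ℕ → ModuleCat.{v} A → Prop
  | 0, X => Projective X
  | (n + 1), X => ∃ (K P : ModuleCat.{v} A) (i : K ⟶ P) (p : P ⟶ X) (w : i ≫ p = 0),
      Module.Finite A P ∧ Projective P ∧ (ShortComplex.mk i p w).ShortExact ∧ fgPdLE n K

/-- `X` has finite projective dimension (within finitely generated modules). -/
def FGHasFinitePd (X : ModuleCat.{v} A) : Prop := ∃ n, fgPdLE n X

/-- `fgGpdLE n X` : `X` admits a resolution `0 → G_n → ⋯ → G_0 → X → 0` by finitely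
generated Gorenstein projective modules. -/
def fgGpdLE : ℕ → ModuleCat.{v} A → Prop
  | 0, X => IsFGGorensteinProjective X
  | (n + 1), X => ∃ (K G : ModuleCat.{v} A) (i : K ⟶ G) (p : G ⟶ X) (w : i ≫ p = 0),
      IsFGGorensteinProjective G ∧ (ShortComplex.mk i p w).ShortExact ∧ fgGpdLE n K

/-- `X` has finite Gorenstein projective dimension (within finitely generated modules). -/
def FGHasFiniteGpd (X : ModuleCat.{v} A) : Prop := ∃ n, fgGpdLE n X

/-- A morphism factors through a finitely generated projective module. -/
def FactorsThroughFGProjective {X Y : ModuleCat.{v} A} (f : X ⟶ Y) : Prop :=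
  ∃ (P : ModuleCat.{v} A) (_ : Module.Finite A P) (_ : Projective P)
    (a : X ⟶ P) (b : P ⟶ Y), f = a ≫ b

/-- `A` is CM-free: every finitely generated Gorenstein projective `A`-module is
projective. -/
def IsCMFree (A : Type u₁) [Ring A] : Prop :=
  ∀ X : ModuleCat.{v} A, IsFGGorensteinProjective X → Projective X

/-- `X` is a direct summand of `G^n` for some `n`. -/
def IsSummandOfPow (G X : ModuleCat.{v} A) : Prop :=
  ∃ (n : ℕ) (Y : ModuleCat.{v} A), Nonempty ((X ⊞ Y) ≅ ⨁ (fun _ : Fin n => G))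

/-- `A` is CM-finite: there is a finitely generated Gorenstein projective `A`-module `G`
such that every finitely generated Gorenstein projective `A`-module is a direct summand
of `G^n` for some `n`. -/
def IsCMFinite (A : Type u₁) [Ring A] : Prop :=
  ∃ G : ModuleCat.{v} A, IsFGGorensteinProjective G ∧
    ∀ X : ModuleCat.{v} A, IsFGGorensteinProjective X → IsSummandOfPow G X

end FGGorensteinPrelude

section GorensteinStableFrobenius

variable {k : Type u₁} [Field k]

/-- A Gorenstein stable Frobenius pair between two algebras `A` and `B`, encoded on the
(ambient) module categories: a Frobenius pair `(F, H)` (both `(F, H)` and `(H, F)` are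
adjoint pairs) of faithful functors preserving finitely generated modules, finitely
generated projective modules and finitely generated Gorenstein projective modules, such
that the cokernel of the unit at every finitely generated Gorenstein projective module and
the kernel of the counit at every finitely generated module of finite Gorenstein
projective dimension have finite projective dimension.  (Exactness of `F` and `H` is
automatic since each is both a left and a right adjoint.) -/
structure GorensteinStableFrobeniusPair (A : Type u₁) [Ring A] (B : Type u₂) [Ring B]
    (F : ModuleCat.{v} A ⥤ ModuleCat.{v} B) (H : ModuleCat.{v} B ⥤ ModuleCat.{v} A) where
  adj₁ : F ⊣ H
  adj₂ : H ⊣ F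
  faithful_F : F.Faithful
  faithful_H : H.Faithful
  fg_F : ∀ X : ModuleCat.{v} A, Module.Finite A X → Module.Finite B (F.obj X)
  fg_H : ∀ Y : ModuleCat.{v} B, Module.Finite B Y → Module.Finite A (H.obj Y)
  proj_F : ∀ X : ModuleCat.{v} A, Module.Finite A X → Projective X → Projective (F.obj X)
  proj_H : ∀ Y : ModuleCat.{v} B, Module.Finite B Y → Projective Y → Projective (H.obj Y)
  gp_F : ∀ X : ModuleCat.{v} A,
    IsFGGorensteinProjective X → IsFGGorensteinProjective (F.obj X)
  gp_H : ∀ Y : ModuleCat.{v} B,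
    IsFGGorensteinProjective Y → IsFGGorensteinProjective (H.obj Y)
  unit_coker : ∀ X : ModuleCat.{v} A, IsFGGorensteinProjective X →
    FGHasFinitePd (cokernel (adj₁.unit.app X))
  counit_ker : ∀ Y : ModuleCat.{v} B, Module.Finite B Y → FGHasFiniteGpd Y →
    FGHasFinitePd (kernel (adj₁.counit.app Y))

end GorensteinStableFrobenius

section MoritaType

open CategoryTheory CategoryTheory.Limits

/-- The pointwise biproduct of two functors into a category with binary biproducts. -/
noncomputable def biprodFunctor {C : Type*} [Category C] {D : Type*} [Category D]
    [Preadditive D] [HasBinaryBiproducts D] (S T : C ⥤ D) : C ⥤ D where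
  obj X := S.obj X ⊞ T.obj X
  map f := biprod.map (S.map f) (T.map f)
  map_id X := by ext <;> simp
  map_comp f g := by ext <;> simp

/-- Bimodules `_B M _A` and `_A N _B` defining a stable equivalence of Morita type of
adjoint type between `A` and `B`, encoded via their tensor functors `F = M ⊗_A -` and
`H = N ⊗_B -` (Mathlib has no tensor product of bimodules over noncommutative rings).
The requirements are: `(F, H)` and `(H, F)` are adjoint pairs (adjoint type); the
composite `H ∘ F` is naturally isomorphic to `𝟭 ⊕ T_P`, where `T_P = P ⊗_A -` takes only
projective values (because the bimodule `P` is projective) and preserves finitely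
generated modules, and symmetrically `F ∘ H ≅ 𝟭 ⊕ T_Q`; moreover `F` and `H` preserve
finitely generated modules.  (Exactness of `F` and `H`, i.e. projectivity of `M` and `N`
as one-sided modules, is automatic since each functor is both a left and a right
adjoint.) -/
structure StableEquivMoritaAdjointType (A : Type u₁) [Ring A] (B : Type u₂) [Ring B]
    (F : ModuleCat.{v} A ⥤ ModuleCat.{v} B) (H : ModuleCat.{v} B ⥤ ModuleCat.{v} A) where
  adj₁ : F ⊣ H
  adj₂ : H ⊣ F
  TP : ModuleCat.{v} A ⥤ ModuleCat.{v} A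
  TQ : ModuleCat.{v} B ⥤ ModuleCat.{v} B
  TP_projective : ∀ X : ModuleCat.{v} A, Projective (TP.obj X)
  TQ_projective : ∀ Y : ModuleCat.{v} B, Projective (TQ.obj Y)
  TP_fg : ∀ X : ModuleCat.{v} A, Module.Finite A X → Module.Finite A (TP.obj X)
  TQ_fg : ∀ Y : ModuleCat.{v} B, Module.Finite B Y → Module.Finite B (TQ.obj Y)
  iso₁ : F ⋙ H ≅ biprodFunctor (𝟭 (ModuleCat.{v} A)) TP
  iso₂ : H ⋙ F ≅ biprodFunctor (𝟭 (ModuleCat.{v} B)) TQ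
  fg_F : ∀ X : ModuleCat.{v} A, Module.Finite A X → Module.Finite B (F.obj X)
  fg_H : ∀ Y : ModuleCat.{v} B, Module.Finite B Y → Module.Finite A (H.obj Y)

end MoritaType

section FrobeniusTransfer

variable {A : Type u₁} [Ring A] {B : Type u₂} [Ring B]
  {F : ModuleCat.{v} A ⥤ ModuleCat.{v} B} {H : ModuleCat.{v} B ⥤ ModuleCat.{v} A}

/-- A functor with the same functor as left and right adjoint preserves totally acyclic
complexes, as long as both functors preserve finitely generated modules. -/
theorem IsFGTotallyAcyclic.map_of_adjunctions [F.Additive] (adj₁ : F ⊣ H) (adj₂ : H ⊣ F)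
    (fg_F : ∀ X : ModuleCat.{v} A, Module.Finite A X → Module.Finite B (F.obj X))
    (fg_H : ∀ Y : ModuleCat.{v} B, Module.Finite B Y → Module.Finite A (H.obj Y))
    {P : ℤ → ModuleCat.{v} A} {d : ∀ n : ℤ, P n ⟶ P (n + 1)} (hP : IsFGTotallyAcyclic P d) :
    IsFGTotallyAcyclic (fun n => F.obj (P n)) (fun n => F.map (d n)) := by
  have := adj₁.leftAdjoint_preservesColimits
  have := adj₂.rightAdjoint_preservesLimits
  have := adj₂.leftAdjoint_preservesColimits
  have : H.PreservesEpimorphisms := inferInstance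
  have : F.PreservesEpimorphisms := inferInstance
  refine ⟨fun n => fg_F _ (hP.finite n), fun n => adj₁.map_projective _ (hP.projective n),
    fun n => by rw [← F.map_comp, hP.comp_eq_zero, F.map_zero],
    fun n => (hP.exact n).map F, fun Q hQ hQ' n g => ?_⟩
  have key := hP.hom_exact (H.obj Q) (fg_H _ hQ) (adj₂.map_projective _ hQ') n
    (adj₁.homEquiv _ _ g)
  have hzero : d n ≫ adj₁.homEquiv _ _ g = 0 ↔ F.map (d n) ≫ g = 0 := by
    rw [← adj₁.homEquiv_naturality_left, ← adj₁.homAddEquiv_apply]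
    exact (adj₁.homAddEquiv _ _).map_eq_zero_iff
  refine hzero.symm.trans (key.trans ⟨?_, ?_⟩)
  · rintro ⟨f, hf⟩
    refine ⟨(adj₁.homEquiv _ _).symm f, (adj₁.homEquiv _ _).injective ?_⟩
    dsimp only at hf ⊢
    rw [adj₁.homEquiv_naturality_left, Equiv.apply_symm_apply, hf]
  · rintro ⟨f, rfl⟩
    exact ⟨adj₁.homEquiv _ _ f, (adj₁.homEquiv_naturality_left _ _).symm⟩

theorem IsFGGorensteinProjective.map_of_adjunctions [F.Additive]
    (adj₁ : F ⊣ H) (adj₂ : H ⊣ F)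
    (fg_F : ∀ X : ModuleCat.{v} A, Module.Finite A X → Module.Finite B (F.obj X))
    (fg_H : ∀ Y : ModuleCat.{v} B, Module.Finite B Y → Module.Finite A (H.obj Y))
    {X : ModuleCat.{v} A} (hX : IsFGGorensteinProjective X) :
    IsFGGorensteinProjective (F.obj X) := by
  obtain ⟨hfin, P, d, hP, n, ⟨e⟩⟩ := hX
  have := adj₂.rightAdjoint_preservesLimits
  exact ⟨fg_F _ hfin, _, _, hP.map_of_adjunctions adj₁ adj₂ fg_F fg_H, n,
    ⟨F.mapIso e ≪≫ PreservesKernel.iso F (d n)⟩⟩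

/-- A direct summand of a direct summand of `G ^ n` is a direct summand of `G ^ n`. -/
theorem IsSummandOfPow.of_biprod_iso {G X Y Z : ModuleCat.{v} A} (hY : IsSummandOfPow G Y)
    (e : Y ≅ X ⊞ Z) : IsSummandOfPow G X := by
  obtain ⟨n, W, ⟨f⟩⟩ := hY
  exact ⟨n, Z ⊞ W,
    ⟨(biprod.associator X Z W).symm ≪≫ biprod.mapIso e.symm (Iso.refl W) ≪≫ f⟩⟩

theorem IsSummandOfPow.map (F : ModuleCat.{v} A ⥤ ModuleCat.{v} B) [F.Additive]
    {G X : ModuleCat.{v} A} (hX : IsSummandOfPow G X) :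
    IsSummandOfPow (F.obj G) (F.obj X) := by
  obtain ⟨n, Y, ⟨e⟩⟩ := hX
  have := preservesBinaryBiproduct_of_preservesBiproduct F X Y
  exact ⟨n, F.obj Y, ⟨(F.mapBiprod X Y).symm ≪≫ F.mapIso e ≪≫ F.mapBiproduct _⟩⟩

theorem IsCMFinite.of_adjunctions [F.Additive] [H.Additive] (adj₁ : F ⊣ H) (adj₂ : H ⊣ F)
    (fg_F : ∀ X : ModuleCat.{v} A, Module.Finite A X → Module.Finite B (F.obj X))
    (fg_H : ∀ Y : ModuleCat.{v} B, Module.Finite B Y → Module.Finite A (H.obj Y))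
    {T : ModuleCat.{v} B ⥤ ModuleCat.{v} B}
    (e : H ⋙ F ≅ biprodFunctor (𝟭 (ModuleCat.{v} B)) T) (hA : IsCMFinite.{v} A) :
    IsCMFinite.{v} B := by
  obtain ⟨G, hG, hsummand⟩ := hA
  refine ⟨F.obj G, hG.map_of_adjunctions adj₁ adj₂ fg_F fg_H, fun X hX => ?_⟩
  have hHX := hsummand _ (hX.map_of_adjunctions adj₂ adj₁ fg_H fg_F)
  exact (hHX.map F).of_biprod_iso (e.app X)

end FrobeniusTransfer

/-- part of Corollary 5.7 of the paper. Suppose bimodules `_B M _A` and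
`_A N _B` define a stable equivalence of Morita type of adjoint type between finite
dimensional `k`-algebras `A` and `B`, encoded via the tensor functors `F = M ⊗_A -` and
`H = N ⊗_B -`. Then `A` is CM-finite if and only if `B` is CM-finite. -/
theorem morita_adjoint_type_cm_finite_iff
    {k : Type u₁} [Field k]
    {A : Type u₁} [Ring A] [Algebra k A] [FiniteDimensional k A]
    {B : Type u₂} [Ring B] [Algebra k B] [FiniteDimensional k B]
    (F : ModuleCat.{v} A ⥤ ModuleCat.{v} B) (H : ModuleCat.{v} B ⥤ ModuleCat.{v} A)
    [F.Additive] [H.Additive]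
    (sem : StableEquivMoritaAdjointType A B F H) :
    IsCMFinite.{v} A ↔ IsCMFinite.{v} B :=
  ⟨IsCMFinite.of_adjunctions sem.adj₁ sem.adj₂ sem.fg_F sem.fg_H sem.iso₂,
    IsCMFinite.of_adjunctions sem.adj₂ sem.adj₁ sem.fg_H sem.fg_F sem.iso₁⟩
end
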